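/- arXiv:1407.1372 — 9 statements merged into one kernel-verified Lean document; each statement's English description precedes it below -/
import Mathlib

section
/- Let D, T ∈ ℝ^{m×n} and let Y ∈ ℝ^{n×n} be invertible, and set X = Y·Yᵀ. Then tr((DX − T)ᵀ(D − T·X⁻¹)) = ‖D·Y − T·Y⁻ᵀ‖_F², where Y⁻ᵀ denotes the transpose of Y⁻¹. -/
open Matrix

/-- The Frobenius norm squared of a real matrix. -/
def frobNormSq {m n : ℕ} (M : Matrix (Fin m) (Fin n) ℝ) : ℝ :=
  ∑ i, ∑ j, (M i j) ^ 2

theorem frobNormSq_eq_trace {m n : ℕ} (M : Matrix (Fin m) (Fin n) ℝ) :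
    frobNormSq M = Matrix.trace (Mᵀ * M) := by
  simp only [frobNormSq, Matrix.trace, Matrix.diag_apply, Matrix.mul_apply,
    Matrix.transpose_apply, pow_two]
  exact Finset.sum_comm

/-- For `D, T ∈ ℝ^{m×n}` and invertible `Y ∈ ℝ^{n×n}`, with `X = Y Yᵀ`,
`tr((DX − T)ᵀ (D − T X⁻¹)) = ‖D Y − T Y⁻ᵀ‖_F²`. -/
theorem stmt0 {m n : ℕ} (D T : Matrix (Fin m) (Fin n) ℝ)
    (Y : Matrix (Fin n) (Fin n) ℝ) (hY : IsUnit Y.det)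
    (X : Matrix (Fin n) (Fin n) ℝ) (hX : X = Y * Yᵀ) :
    Matrix.trace ((D * X - T)ᵀ * (D - T * X⁻¹)) =
      frobNormSq (D * Y - T * (Y⁻¹)ᵀ) := by
  have h_left : D * X - T = (D * Y - T * (Y⁻¹)ᵀ) * Yᵀ := by
    rw [hX, Matrix.sub_mul, Matrix.mul_assoc T, ← Matrix.transpose_mul,
      Matrix.mul_nonsing_inv Y hY, Matrix.transpose_one, Matrix.mul_one, Matrix.mul_assoc]
  have h_right : D - T * X⁻¹ = (D * Y - T * (Y⁻¹)ᵀ) * Y⁻¹ := by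
    rw [hX, Matrix.mul_inv_rev, ← Matrix.transpose_nonsing_inv, Matrix.sub_mul,
      Matrix.mul_assoc D, Matrix.mul_nonsing_inv Y hY, Matrix.mul_one, Matrix.mul_assoc]
  rw [h_left, h_right, frobNormSq_eq_trace, Matrix.transpose_mul, Matrix.transpose_transpose,
    ← Matrix.mul_assoc, Matrix.trace_mul_comm, ← Matrix.mul_assoc, ← Matrix.mul_assoc,
    Matrix.nonsing_inv_mul Y hY, Matrix.one_mul]
end

section
/- Let D, T ∈ ℝ^{m×n} and let X ∈ ℝ^{n×n} be symmetric positive definite. Then tr((DX − T)ᵀ(D − T·X⁻¹)) ≥ 0, and tr((DX − T)ᵀ(D − T·X⁻¹)) = 0 if and only if D·X = T. -/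
open Matrix

theorem Matrix.trace_mul_mul_transpose_eq_sum {m n : Type*} [Fintype m] [Fintype n]
    (R : Matrix m n ℝ) (A : Matrix n n ℝ) :
    (R * A * Rᵀ).trace = ∑ i, R i ⬝ᵥ A *ᵥ R i := by
  refine Finset.sum_congr rfl fun i _ => ?_
  rw [dotProduct_mulVec]
  rfl

theorem Matrix.PosDef.trace_mul_mul_transpose_nonneg {m n : Type*} [Fintype m] [Fintype n]
    {A : Matrix n n ℝ} (hA : A.PosDef) (R : Matrix m n ℝ) : 0 ≤ (R * A * Rᵀ).trace := by
  simpa using (hA.posSemidef.mul_mul_conjTranspose_same R).trace_nonneg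

theorem Matrix.PosDef.trace_mul_mul_transpose_eq_zero_iff {m n : Type*} [Fintype m] [Fintype n]
    {A : Matrix n n ℝ} (hA : A.PosDef) (R : Matrix m n ℝ) :
    (R * A * Rᵀ).trace = 0 ↔ R = 0 := by
  refine ⟨fun h => ?_, fun h => by simp [h]⟩
  rw [trace_mul_mul_transpose_eq_sum, Finset.sum_eq_zero_iff_of_nonneg fun i _ => by
    simpa using hA.posSemidef.dotProduct_mulVec_nonneg (R i)] at h
  funext i
  by_contra hi
  have hpos : 0 < R i ⬝ᵥ A *ᵥ R i := by simpa using hA.dotProduct_mulVec_pos hi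
  exact hpos.ne' (h i (Finset.mem_univ i))

/-- For `D, T ∈ ℝ^{m×n}` and symmetric positive definite `X ∈ ℝ^{n×n}`,
the error `E = tr((DX − T)ᵀ (D − T X⁻¹))` is nonnegative, and it vanishes
if and only if `D X = T`. -/
theorem stmt1 {m n : ℕ} (D T : Matrix (Fin m) (Fin n) ℝ)
    (X : Matrix (Fin n) (Fin n) ℝ) (hX : X.PosDef) :
    0 ≤ Matrix.trace ((D * X - T)ᵀ * (D - T * X⁻¹)) ∧
      (Matrix.trace ((D * X - T)ᵀ * (D - T * X⁻¹)) = 0 ↔ D * X = T) := by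
  have hdet : IsUnit X.det := hX.det_pos.ne'.isUnit
  have hfactor : D - T * X⁻¹ = (D * X - T) * X⁻¹ := by
    rw [Matrix.sub_mul, Matrix.mul_nonsing_inv_cancel_right _ _ hdet]
  rw [hfactor, Matrix.trace_mul_comm]
  exact ⟨hX.inv.trace_mul_mul_transpose_nonneg _,
    (hX.inv.trace_mul_mul_transpose_eq_zero_iff _).trans sub_eq_zero⟩
end

section
/- Let A ∈ ℝ^{n×n} be given by A = U·S²·Uᵀ where U is orthogonal (UᵀU = UUᵀ = I) and S is diagonal and invertible, and let B ∈ ℝ^{n×n} be symmetric positive definite. Suppose S·Uᵀ·B·U·S = Ū·S̄²·Ūᵀ where Ū is orthogonal and S̄ is diagonal with positive diagonal entries. Then X* = U·S⁻¹·Ū·S̄·Ūᵀ·S⁻¹·Uᵀ is symmetric positive definite and satisfies X*·A·X* = B. -/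
open Matrix

/-- If `A = U S² Uᵀ` with `U` orthogonal and `S` diagonal invertible, `B` is
symmetric positive definite, and `S Uᵀ B U S = Ū S̄² Ūᵀ` with `Ū` orthogonal and
`S̄` diagonal with positive diagonal entries, then
`X* = U S⁻¹ Ū S̄ Ūᵀ S⁻¹ Uᵀ` is symmetric positive definite and satisfies
`X* A X* = B`. -/
theorem stmt3 {n : ℕ} (A B U S Ub Sb : Matrix (Fin n) (Fin n) ℝ)
    (hU1 : Uᵀ * U = 1) (hU2 : U * Uᵀ = 1)
    (hS : S.IsDiag) (hSdet : IsUnit S.det)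
    (hA : A = U * (S * S) * Uᵀ)
    (hB : B.PosDef)
    (hUb1 : Ubᵀ * Ub = 1) (hUb2 : Ub * Ubᵀ = 1)
    (hSb : Sb.IsDiag) (hSbpos : ∀ i, 0 < Sb i i)
    (hdecomp : S * Uᵀ * B * U * S = Ub * (Sb * Sb) * Ubᵀ) :
    (U * S⁻¹ * Ub * Sb * Ubᵀ * S⁻¹ * Uᵀ).PosDef ∧
      (U * S⁻¹ * Ub * Sb * Ubᵀ * S⁻¹ * Uᵀ) * A * (U * S⁻¹ * Ub * Sb * Ubᵀ * S⁻¹ * Uᵀ) = B := by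
  have cancel {P Q : Matrix (Fin n) (Fin n) ℝ} (h : P * Q = 1)
      (Z : Matrix (Fin n) (Fin n) ℝ) : P * (Q * Z) = Z := by
    rw [← Matrix.mul_assoc, h, Matrix.one_mul]
  have hS1 : S⁻¹ * S = 1 := nonsing_inv_mul S hSdet
  have hS2 : S * S⁻¹ = 1 := mul_nonsing_inv S hSdet
  constructor
  · have hD : Sb.PosDef := by
      rw [← hSb.diagonal_diag]
      exact posDef_diagonal_iff.2 hSbpos
    have hW : IsUnit (U * S⁻¹ * Ub) :=
      IsUnit.of_mul_eq_one (Ubᵀ * (S * Uᵀ)) (by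
        simp only [Matrix.mul_assoc, cancel hUb2, cancel hS1, hU2])
    have hX := hW.posDef_star_right_conjugate_iff.2 hD
    simpa only [star_eq_conjTranspose, conjTranspose_eq_transpose_of_trivial, transpose_mul,
      transpose_nonsing_inv, hS.isSymm.eq, Matrix.mul_assoc] using hX
  · calc
      _ = U * S⁻¹ * (Ub * (Sb * Sb) * Ubᵀ) * S⁻¹ * Uᵀ := by
        simp only [hA, Matrix.mul_assoc, cancel hU1, cancel hS1, cancel hS2, cancel hUb1]
      _ = B := by
        rw [← hdecomp]
        simp only [Matrix.mul_assoc, cancel hS1, cancel hS2, cancel hU2, hU2, Matrix.mul_one]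
end

section
/- Let A, B ∈ ℝ^{n×n} be symmetric positive definite, and suppose X* ∈ ℝ^{n×n} is symmetric positive definite and satisfies X*·A·X* = B. Then X* is a global minimizer of Φ(X) = tr(A·X + X⁻¹·B) over the cone of symmetric positive definite matrices; that is, for every symmetric positive definite X ∈ ℝ^{n×n}, tr(A·X* + (X*)⁻¹·B) ≤ tr(A·X + X⁻¹·B). -/
open Matrix

open scoped MatrixOrder in
/-- The trace of a product of two positive semidefinite real matrices is nonnegative. -/
theorem Matrix.PosSemidef.trace_mul_nonneg_real {ι : Type*} [Fintype ι] [DecidableEq ι]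
    {P Q : Matrix ι ι ℝ} (hP : P.PosSemidef) (hQ : Q.PosSemidef) : 0 ≤ (P * Q).trace := by
  obtain ⟨C, rfl⟩ := CStarAlgebra.nonneg_iff_eq_star_mul_self.mp hP.nonneg
  rw [Matrix.star_eq_conjTranspose, Matrix.mul_assoc, Matrix.trace_mul_comm]
  exact (hQ.mul_mul_conjTranspose_same C).trace_nonneg

/-- If `A, B` are symmetric positive definite and the symmetric positive definite
matrix `X*` satisfies `X* A X* = B`, then `X*` is a global minimizer of
`Φ(X) = tr(A X + X⁻¹ B)` over the cone of symmetric positive definite matrices. -/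
theorem stmt4 {n : ℕ} (A B Xs : Matrix (Fin n) (Fin n) ℝ)
    (hA : A.PosDef) (hB : B.PosDef) (hXs : Xs.PosDef)
    (heq : Xs * A * Xs = B) :
    ∀ X : Matrix (Fin n) (Fin n) ℝ, X.PosDef →
      Matrix.trace (A * Xs + Xs⁻¹ * B) ≤ Matrix.trace (A * X + X⁻¹ * B) := by
  intro X hX
  have hXdet : IsUnit X.det := (Matrix.isUnit_iff_isUnit_det X).mp hX.isUnit
  have hXsdet : IsUnit Xs.det := (Matrix.isUnit_iff_isUnit_det Xs).mp hXs.isUnit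
  have hpsd : ((X - Xs) * X⁻¹ * (X - Xs)).PosSemidef := by
    have h := hX.inv.posSemidef.mul_mul_conjTranspose_same (X - Xs)
    rwa [(hX.isHermitian.sub hXs.isHermitian).eq] at h
  have hexpand : (X - Xs) * X⁻¹ * (X - Xs) = X - Xs - Xs + Xs * X⁻¹ * Xs := by
    rw [Matrix.sub_mul, Matrix.mul_nonsing_inv X hXdet, Matrix.mul_sub, Matrix.sub_mul,
      Matrix.sub_mul, Matrix.mul_assoc Xs X⁻¹ X, Matrix.nonsing_inv_mul X hXdet]
    simp only [Matrix.one_mul, Matrix.mul_one]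
    abel
  have hnonneg := hA.posSemidef.trace_mul_nonneg_real hpsd
  have hmin : Xs⁻¹ * B = A * Xs := by
    rw [← heq, Matrix.mul_assoc, Matrix.nonsing_inv_mul_cancel_left Xs _ hXsdet]
  have hcycle : (X⁻¹ * B).trace = (A * (Xs * X⁻¹ * Xs)).trace := by
    rw [← heq, Matrix.mul_assoc Xs A Xs, ← Matrix.mul_assoc X⁻¹, Matrix.trace_mul_comm,
      Matrix.mul_assoc A, Matrix.mul_assoc Xs]
  rw [hexpand, Matrix.mul_add, Matrix.mul_sub, Matrix.mul_sub, Matrix.trace_add,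
    Matrix.trace_sub, Matrix.trace_sub] at hnonneg
  rw [hmin, Matrix.trace_add, Matrix.trace_add, hcycle]
  linarith
end

section
/- Let A, B ∈ ℝ^{n×n} be symmetric positive definite. If X₁ and X₂ are symmetric positive definite matrices with X₁·A·X₁ = B and X₂·A·X₂ = B, then X₁ = X₂. In other words, the matrix equation X·A·X = B has at most one symmetric positive definite solution. -/
open Matrix

open scoped MatrixOrder Matrix.Norms.L2Operator in
/-- For `A` positive definite, `X ↦ X A X` is injective on positive semidefinite matrices:
conjugating by `R = √A` turns it into squaring. -/
theorem Matrix.PosDef.eq_of_mul_mul_self_eq {ι : Type*} [Fintype ι] [DecidableEq ι]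
    {A X Y : Matrix ι ι ℝ} (hA : A.PosDef) (hX : X.PosSemidef) (hY : Y.PosSemidef)
    (hXY : X * A * X = Y * A * Y) : X = Y := by
  set R := CFC.sqrt A
  have hRA : R * R = A := CFC.sqrt_mul_sqrt_self A hA.posSemidef.nonneg
  have hR : R.PosSemidef := Matrix.nonneg_iff_posSemidef.mp (CFC.sqrt_nonneg A)
  have hRu : IsUnit R := isUnit_of_mul_isUnit_left (hRA ▸ hA.isUnit)
  have hpos {Z : Matrix ι ι ℝ} (hZ : Z.PosSemidef) : 0 ≤ R * Z * R := by
    simpa only [hR.isHermitian.eq] using (hZ.mul_mul_conjTranspose_same R).nonneg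
  have hsq (Z : Matrix ι ι ℝ) : R * Z * R * (R * Z * R) = R * (Z * A * Z) * R := by
    simp only [← hRA, mul_assoc]
  have h : R * X * R = R * Y * R :=
    (CFC.mul_self_eq_mul_self_iff _ _ (hpos hX) (hpos hY)).mp (by rw [hsq, hsq, hXY])
  exact hRu.mul_left_cancel (hRu.mul_right_cancel h)

/-- For symmetric positive definite `A, B`, the matrix equation `X A X = B` has
at most one symmetric positive definite solution. -/
theorem stmt5 {n : ℕ} (A B : Matrix (Fin n) (Fin n) ℝ)
    (hA : A.PosDef) (hB : B.PosDef)
    (X₁ X₂ : Matrix (Fin n) (Fin n) ℝ) (hX₁ : X₁.PosDef) (hX₂ : X₂.PosDef)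
    (h1 : X₁ * A * X₁ = B) (h2 : X₂ * A * X₂ = B) :
    X₁ = X₂ :=
  hA.eq_of_mul_mul_self_eq hX₁.posSemidef hX₂.posSemidef (h1.trans h2.symm)
end

section
/- Let A, B ∈ ℝ^{n×n} be symmetric positive semidefinite. Then the function Φ(X) = tr(A·X + X⁻¹·B) is convex on the cone of symmetric positive definite matrices: for all symmetric positive definite X, Y ∈ ℝ^{n×n} and all t ∈ [0,1], tr(A·(tX + (1−t)Y) + (tX + (1−t)Y)⁻¹·B) ≤ t·tr(A·X + X⁻¹·B) + (1−t)·tr(A·Y + Y⁻¹·B). -/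
open Matrix

open scoped MatrixOrder in
theorem Matrix.PosSemidef.trace_mul_nonneg {n : Type*} [Fintype n] [DecidableEq n]
    {M B : Matrix n n ℝ} (hM : M.PosSemidef) (hB : B.PosSemidef) : 0 ≤ (M * B).trace := by
  obtain ⟨C, rfl⟩ := CStarAlgebra.nonneg_iff_eq_star_mul_self.mp hB.nonneg
  rw [← Matrix.mul_assoc, Matrix.trace_mul_comm, ← Matrix.mul_assoc]
  exact (hM.mul_mul_conjTranspose_same C).trace_nonneg

/-- The tangent-plane inequality `X⁻¹ ≥ 2 Z⁻¹ - Z⁻¹ X Z⁻¹` in the Loewner order. -/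
theorem Matrix.PosDef.posSemidef_inv_sub_tangent {n : Type*} [Fintype n] [DecidableEq n]
    {X Z : Matrix n n ℝ} (hX : X.PosDef) (hZ : Z.PosDef) :
    (X⁻¹ - (2 : ℝ) • Z⁻¹ + Z⁻¹ * X * Z⁻¹).PosSemidef := by
  have h := hX.posSemidef.mul_mul_conjTranspose_same (X⁻¹ - Z⁻¹)
  have hdet := (Matrix.isUnit_iff_isUnit_det X).mp hX.isUnit
  rw [(hX.inv.isHermitian.sub hZ.inv.isHermitian).eq, Matrix.sub_mul, Matrix.mul_sub,
    Matrix.nonsing_inv_mul X hdet, Matrix.sub_mul, Matrix.sub_mul, Matrix.one_mul, Matrix.one_mul,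
    Matrix.mul_assoc Z⁻¹ X X⁻¹, Matrix.mul_nonsing_inv X hdet, Matrix.mul_one] at h
  convert! h using 1
  rw [two_smul]
  abel

/-- The matrix inverse is convex on the positive definite cone, in the Loewner order. -/
theorem Matrix.PosDef.posSemidef_convex_inv {n : Type*} [Fintype n] [DecidableEq n]
    {X Y : Matrix n n ℝ} (hX : X.PosDef) (hY : Y.PosDef) {t : ℝ} (ht : t ∈ Set.Icc (0 : ℝ) 1) :
    (t • X⁻¹ + (1 - t) • Y⁻¹ - (t • X + (1 - t) • Y)⁻¹).PosSemidef := by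
  have hZ : (t • X + (1 - t) • Y).PosDef := by
    rcases ht.1.eq_or_lt with rfl | h0
    · simpa using hY
    · exact (hX.smul h0).add_posSemidef (hY.posSemidef.smul (sub_nonneg.mpr ht.2))
  have h := ((hX.posSemidef_inv_sub_tangent hZ).smul ht.1).add
    ((hY.posSemidef_inv_sub_tangent hZ).smul (sub_nonneg.mpr ht.2))
  set Z := t • X + (1 - t) • Y with hZdef
  have hmul : t • (Z⁻¹ * X * Z⁻¹) + (1 - t) • (Z⁻¹ * Y * Z⁻¹) = Z⁻¹ := by
    calc _ = Z⁻¹ * Z * Z⁻¹ := by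
          simp only [hZdef, Matrix.mul_add, Matrix.add_mul, Matrix.mul_smul, Matrix.smul_mul]
      _ = Z⁻¹ := by
          rw [Matrix.nonsing_inv_mul Z ((Matrix.isUnit_iff_isUnit_det Z).mp hZ.isUnit),
            Matrix.one_mul]
  convert! h using 1
  linear_combination (norm := module) (-1 : ℝ) • hmul

/-- For symmetric positive semidefinite `A, B`, the function
`Φ(X) = tr(A X + X⁻¹ B)` is convex on the cone of symmetric positive definite
matrices. -/
theorem stmt6 {n : ℕ} (A B : Matrix (Fin n) (Fin n) ℝ)
    (hA : A.PosSemidef) (hB : B.PosSemidef) :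
    ∀ X Y : Matrix (Fin n) (Fin n) ℝ, X.PosDef → Y.PosDef →
      ∀ t : ℝ, t ∈ Set.Icc (0 : ℝ) 1 →
        Matrix.trace (A * (t • X + (1 - t) • Y) + (t • X + (1 - t) • Y)⁻¹ * B) ≤
          t * Matrix.trace (A * X + X⁻¹ * B) + (1 - t) * Matrix.trace (A * Y + Y⁻¹ * B) := by
  intro X Y hX hY t ht
  have h := (hX.posSemidef_convex_inv hY ht).trace_mul_nonneg hB
  simp only [Matrix.sub_mul, Matrix.add_mul, Matrix.mul_add, Matrix.smul_mul, Matrix.mul_smul,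
    Matrix.trace_add, Matrix.trace_sub, Matrix.trace_smul, smul_eq_mul] at h ⊢
  linarith
end

section
/- Let A, B ∈ ℝ^{n×n} be symmetric positive definite, and let X* be a symmetric positive definite matrix such that tr(A·X* + (X*)⁻¹·B) ≤ tr(A·X + X⁻¹·B) for every symmetric positive definite X ∈ ℝ^{n×n}. Then X*·A·X* = B. -/
open Matrix

/-- The first-order condition for a minimizer of `tr(A X + X⁻¹ B)`, tested in the positive
semidefinite direction `v vᵀ`. -/
theorem Matrix.PosDef.dotProduct_inv_mul_mul_inv_le_of_isMin {ι : Type*} [Fintype ι]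
    [DecidableEq ι] {A B X : Matrix ι ι ℝ} (hX : X.PosDef)
    (hmin : ∀ Z : Matrix ι ι ℝ, Z.PosDef →
      trace (A * X + X⁻¹ * B) ≤ trace (A * Z + Z⁻¹ * B)) (v : ι → ℝ) :
    v ⬝ᵥ ((X⁻¹ * B * X⁻¹) *ᵥ v) ≤ v ⬝ᵥ (A *ᵥ v) := by
  let H := vecMulVec v v
  have hH : H.PosSemidef := by simpa using posSemidef_vecMulVec_self_star v
  have trace_mul_H (M : Matrix ι ι ℝ) : trace (M * H) = v ⬝ᵥ (M *ᵥ v) := by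
    rw [mul_vecMulVec, trace_vecMulVec, dotProduct_comm]
  have bound (t : ℝ) (ht : 0 < t) : trace (((X + t • H)⁻¹ * B * X⁻¹) * H) ≤ trace (A * H) := by
    have hZ : (X + t • H).PosDef := hX.add_posSemidef (hH.smul ht.le)
    have resolvent : (X + t • H)⁻¹ = X⁻¹ - t • (X⁻¹ * H * (X + t • H)⁻¹) := by
      have h := Matrix.inv_sub_inv (iff_of_true hX.isUnit hZ.isUnit)
      rw [add_sub_cancel_left, Matrix.mul_smul, Matrix.smul_mul] at h
      rw [← h, sub_sub_cancel]
    have cyclic : trace (X⁻¹ * H * (X + t • H)⁻¹ * B) =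
        trace ((X + t • H)⁻¹ * B * X⁻¹ * H) := by
      rw [Matrix.mul_assoc, trace_mul_comm, ← Matrix.mul_assoc]
    have h := hmin _ hZ
    rw [trace_add, trace_add, congrArg (fun Y => trace (Y * B)) resolvent] at h
    simp only [Matrix.sub_mul, Matrix.smul_mul, Matrix.mul_add, Matrix.mul_smul, trace_add,
      trace_sub, trace_smul, smul_eq_mul, cyclic] at h
    exact le_of_mul_le_mul_left (by linarith) ht
  have hcont : ContinuousAt (fun t : ℝ => trace (((X + t • H)⁻¹ * B * X⁻¹) * H)) 0 := by
    have : ContinuousAt (fun t : ℝ => (X + t • H)⁻¹) 0 := by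
      have hdet : (X + (0 : ℝ) • H).det ≠ 0 := by
        simpa using ((X.isUnit_iff_isUnit_det).1 hX.isUnit).ne_zero
      have hinv : ContinuousAt Ring.inverse (X + (0 : ℝ) • H).det := by
        simpa only [Ring.inverse_eq_inv'] using continuousAt_inv₀ hdet
      exact (continuousAt_matrix_inv _ hinv).comp (f := fun t : ℝ => X + t • H) (by fun_prop)
    fun_prop
  rw [← trace_mul_H, ← trace_mul_H]
  have hlim := hcont.tendsto.mono_left (nhdsWithin_le_nhds (s := Set.Ioi 0))
  simp only [zero_smul, add_zero] at hlim
  exact le_of_tendsto hlim (Filter.eventually_of_mem self_mem_nhdsWithin bound)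

/-- If `A, B` are symmetric positive definite and the symmetric positive definite
matrix `X*` is a global minimizer of `Φ(X) = tr(A X + X⁻¹ B)` over the cone of
symmetric positive definite matrices, then `X* A X* = B`. -/
theorem stmt7 {n : ℕ} (A B Xs : Matrix (Fin n) (Fin n) ℝ)
    (hA : A.PosDef) (hB : B.PosDef) (hXs : Xs.PosDef)
    (hmin : ∀ X : Matrix (Fin n) (Fin n) ℝ, X.PosDef →
      Matrix.trace (A * Xs + Xs⁻¹ * B) ≤ Matrix.trace (A * X + X⁻¹ * B)) :
    Xs * A * Xs = B := by
  have hinv : IsUnit Xs.det := (Xs.isUnit_iff_isUnit_det).1 hXs.isUnit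
  have hsymm : (Xs * A * Xs).IsHermitian := by
    simpa only [hXs.isHermitian.eq] using isHermitian_mul_mul_conjTranspose Xs hA.isHermitian
  have lower : (Xs * A * Xs - B).PosSemidef := by
    have : (A - Xs⁻¹ * B * Xs⁻¹).PosSemidef := by
      refine .of_dotProduct_mulVec_nonneg (hA.isHermitian.sub ?_) fun v => ?_
      · simpa only [hXs.inv.isHermitian.eq] using
          isHermitian_mul_mul_conjTranspose Xs⁻¹ hB.isHermitian
      · simpa [sub_mulVec, dotProduct_sub] using
          hXs.dotProduct_inv_mul_mul_inv_le_of_isMin hmin v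
    have h := this.mul_mul_conjTranspose_same Xs
    rw [hXs.isHermitian.eq] at h
    have cancel : Xs * (Xs⁻¹ * B * Xs⁻¹) * Xs = B := by
      rw [Matrix.mul_assoc Xs⁻¹, mul_nonsing_inv_cancel_left _ _ hinv,
        nonsing_inv_mul_cancel_right _ _ hinv]
    rwa [mul_sub, sub_mul, cancel] at h
  have upper : (B - Xs * A * Xs).PosSemidef := by
    refine .of_dotProduct_mulVec_nonneg (hB.isHermitian.sub hsymm) fun v => ?_
    have h := hXs.inv.dotProduct_inv_mul_mul_inv_le_of_isMin (A := B) (B := A)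
      (fun Z hZ => by
        have h := hmin _ hZ.inv
        rw [nonsing_inv_nonsing_inv _ ((Z.isUnit_iff_isUnit_det).1 hZ.isUnit)] at h
        rw [nonsing_inv_nonsing_inv _ hinv]
        simp only [trace_add] at h ⊢
        rw [trace_mul_comm B Xs⁻¹, trace_mul_comm B Z, trace_mul_comm Xs, trace_mul_comm Z⁻¹]
        linarith) v
    rw [nonsing_inv_nonsing_inv _ hinv] at h
    simpa [sub_mulVec, dotProduct_sub] using h
  open scoped MatrixOrder in
  exact le_antisymm (Matrix.le_iff.2 upper) (Matrix.le_iff.2 lower)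
end

section
/- Let M ∈ ℝ^{r×r} be invertible and let Σ ∈ ℝ^{r×r} be diagonal with positive diagonal entries. If M⁻ᵀ·Σ⁻²·M⁻¹ = M·Σ⁻²·Mᵀ, then Mᵀ·M = I, i.e., M is orthogonal. Conversely, if MᵀM = I then M⁻ᵀ·Σ⁻²·M⁻¹ = M·Σ⁻²·Mᵀ. -/
open Matrix

open scoped MatrixOrder Matrix.Norms.L2Operator in
/-- Positive semidefinite real matrices with the same square are equal. -/
theorem Matrix.PosSemidef.eq_of_mul_self_eq {n : Type*} [Fintype n] [DecidableEq n]
    {A B : Matrix n n ℝ} (hA : A.PosSemidef) (hB : B.PosSemidef) (h : A * A = B * B) :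
    A = B :=
  (CFC.sqrt_unique h hA.nonneg).symm.trans (CFC.sqrt_unique rfl hB.nonneg)

/-- An invertible symmetric `S` and a Gram matrix `Mᵀ * M` that fixes `S * S` under congruence
force `Mᵀ * M = 1`. -/
theorem Matrix.gram_eq_one_of_mul_mul_eq {n : Type*} [Fintype n] [DecidableEq n]
    {M S : Matrix n n ℝ} (hS : IsUnit S) (hSt : Sᵀ = S)
    (h : Mᵀ * M * (S * S) * (Mᵀ * M) = S * S) : Mᵀ * M = 1 := by
  have hGram : (S * (Mᵀ * M) * S).PosSemidef := by
    simpa [conjTranspose_eq_transpose_of_trivial, hSt, Matrix.mul_assoc] using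
      posSemidef_conjTranspose_mul_self (M * S)
  have hSq : (S * S).PosSemidef := by
    simpa [conjTranspose_eq_transpose_of_trivial, hSt] using posSemidef_conjTranspose_mul_self S
  have key : S * (Mᵀ * M) * S = S * S := by
    refine hGram.eq_of_mul_self_eq hSq ?_
    calc S * (Mᵀ * M) * S * (S * (Mᵀ * M) * S)
        = S * (Mᵀ * M * (S * S) * (Mᵀ * M)) * S := by simp only [Matrix.mul_assoc]
      _ = S * S * (S * S) := by rw [h]; simp only [Matrix.mul_assoc]
  have hleft : S * (Mᵀ * M) = S * 1 := by
    rw [Matrix.mul_one]; exact hS.mul_right_cancel key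
  exact hS.mul_left_cancel hleft

/-- Let `M ∈ ℝ^{r×r}` be invertible and `Σ ∈ ℝ^{r×r}` diagonal with positive
diagonal entries. Then `M⁻ᵀ Σ⁻² M⁻¹ = M Σ⁻² Mᵀ` holds if and only if
`Mᵀ M = I`, i.e. `M` is orthogonal. -/
theorem stmt12 {r : ℕ} (M Sig : Matrix (Fin r) (Fin r) ℝ)
    (hM : IsUnit M.det) (hSig : Sig.IsDiag) (hSigpos : ∀ i, 0 < Sig i i) :
    (M⁻¹)ᵀ * (Sig * Sig)⁻¹ * M⁻¹ = M * (Sig * Sig)⁻¹ * Mᵀ ↔ Mᵀ * M = 1 := by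
  have hSt : Sigᵀ = Sig := hSig.isSymm
  have hSu : IsUnit Sig := by
    rw [← hSig.diagonal_diag, isUnit_diagonal, Pi.isUnit_iff]
    exact fun i => (hSigpos i).ne'.isUnit
  have hMt : IsUnit Mᵀ.det := by rwa [det_transpose]
  rw [Matrix.mul_inv_rev, transpose_nonsing_inv]
  constructor
  · intro h
    refine gram_eq_one_of_mul_mul_eq (S := Sig⁻¹) (isUnit_nonsing_inv_iff.mpr hSu)
      (by rw [transpose_nonsing_inv, hSt]) ?_
    calc Mᵀ * M * (Sig⁻¹ * Sig⁻¹) * (Mᵀ * M)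
        = Mᵀ * (M * (Sig⁻¹ * Sig⁻¹) * Mᵀ) * M := by simp only [Matrix.mul_assoc]
      _ = (Mᵀ * Mᵀ⁻¹) * (Sig⁻¹ * Sig⁻¹) * (M⁻¹ * M) := by
        rw [← h]; simp only [Matrix.mul_assoc]
      _ = Sig⁻¹ * Sig⁻¹ := by
        rw [mul_nonsing_inv _ hMt, nonsing_inv_mul _ hM, Matrix.one_mul, Matrix.mul_one]
  · intro h
    rw [inv_eq_left_inv h, inv_eq_right_inv h]
end

section
/- Let r < n, let X̃_rr ∈ ℝ^{r×r} be symmetric positive definite with Cholesky factorization X̃_rr = L_rr·L_rrᵀ (L_rr lower triangular and invertible), let X̃_{r,n−r} ∈ ℝ^{r×(n−r)} be arbitrary, let L_{n−r,r} ∈ ℝ^{(n−r)×r} be defined by L_{n−r,r}ᵀ = L_rr⁻¹·X̃_{r,n−r}, let L_{n−r,n−r} ∈ ℝ^{(n−r)×(n−r)} be any invertible lower triangular matrix, and set X̃_{n−r,n−r} = L_{n−r,r}·L_{n−r,r}ᵀ + L_{n−r,n−r}·L_{n−r,n−r}ᵀ. Then the block matrix X̃ = [[X̃_rr, X̃_{r,n−r}],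 [X̃_{r,n−r}ᵀ, X̃_{n−r,n−r}]] ∈ ℝ^{n×n} is symmetric positive definite. -/
open Matrix

/-- Completion of a partially specified matrix to a symmetric positive definite
one: with `X̃_rr = L_rr L_rrᵀ` a Cholesky factorization, `L_{n−r,r}ᵀ = L_rr⁻¹ X̃_{r,n−r}`,
an arbitrary invertible lower triangular `L_{n−r,n−r}`, and
`X̃_{n−r,n−r} = L_{n−r,r} L_{n−r,r}ᵀ + L_{n−r,n−r} L_{n−r,n−r}ᵀ`, the block matrix
`[[X̃_rr, X̃_{r,n−r}], [X̃_{r,n−r}ᵀ, X̃_{n−r,n−r}]]` is symmetric positive definite. -/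
theorem stmt15 {n r : ℕ} (hrn : r < n)
    (Xrr : Matrix (Fin r) (Fin r) ℝ) (hXrr : Xrr.PosDef)
    (Lrr : Matrix (Fin r) (Fin r) ℝ)
    (hLrrLow : ∀ i j : Fin r, i < j → Lrr i j = 0)
    (hLrrInv : IsUnit Lrr.det)
    (hChol : Xrr = Lrr * Lrrᵀ)
    (Xrn : Matrix (Fin r) (Fin (n - r)) ℝ)
    (Lnr : Matrix (Fin (n - r)) (Fin r) ℝ) (hLnr : Lnrᵀ = Lrr⁻¹ * Xrn)
    (Lnn : Matrix (Fin (n - r)) (Fin (n - r)) ℝ)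
    (hLnnLow : ∀ i j : Fin (n - r), i < j → Lnn i j = 0)
    (hLnnInv : IsUnit Lnn.det)
    (Xnn : Matrix (Fin (n - r)) (Fin (n - r)) ℝ)
    (hXnn : Xnn = Lnr * Lnrᵀ + Lnn * Lnnᵀ) :
    (fromBlocks Xrr Xrn Xrnᵀ Xnn).PosDef := by
  have hXrn : Xrn = Lrr * Lnrᵀ := by
    rw [hLnr, mul_nonsing_inv_cancel_left _ _ hLrrInv]
  have hfact : fromBlocks Xrr Xrn Xrnᵀ Xnn =
      fromBlocks Lrr 0 Lnr Lnn * (fromBlocks Lrr 0 Lnr Lnn)ᴴ := by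
    rw [conjTranspose_eq_transpose_of_trivial, fromBlocks_transpose, fromBlocks_multiply,
      hChol, hXrn, hXnn]
    simp
  have hunit : IsUnit (fromBlocks Lrr 0 Lnr Lnn) := by
    rw [isUnit_iff_isUnit_det, det_fromBlocks_zero₁₂]
    exact hLrrInv.mul hLnnInv
  rw [hfact]
  exact PosDef.mul_conjTranspose_self _ (vecMul_injective_of_isUnit hunit)
end
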